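/- Let H be a set of n non-vertical planes in ℝ³ in general position. The total combinatorial complexity (number of vertices) of the first k levels L_{≤k} of Arr(H) is O(n k²). Consequently, for any constant 0 < c < 1 and any interval of levels [(1+c)n/r, (1+2c)n/r] of length cn/r, there exists a level ξ in this interval whose complexity is O(n²/(c r)). -/

import Mathlib

open scoped Classical

/-- A non-vertical plane in `ℝ³`, represented by coefficients `(a, b, c)`:
the graph `z = a·x + b·y + c`. -/
abbrev GPlane := ℝ × ℝ × ℝ

/-- The set of points of the plane `h`. -/
def gpset (h : GPlane) : Set (Fin 3 → ℝ) :=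
  {x | x 2 = h.1 * x 0 + h.2.1 * x 1 + h.2.2}

/-- The plane `h` lies strictly (vertically) below the point `z`. -/
def IsBelow (h : GPlane) (z : Fin 3 → ℝ) : Prop :=
  h.1 * z 0 + h.2.1 * z 1 + h.2.2 < z 2

/-- The level of a point `z`: the number of planes of `H` strictly below `z`. -/
noncomputable def levelOf (H : Finset GPlane) (z : Fin 3 → ℝ) : ℕ :=
  (H.filter (fun h => IsBelow h z)).card

/-- The `k`-level of the arrangement of `H`: the closure of the set of points
lying on some plane of `H` at level exactly `k`. -/
noncomputable def kLevel (H : Finset GPlane) (k : ℕ) : Set (Fin 3 → ℝ) :=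
  closure {z | (∃ h ∈ H, z ∈ gpset h) ∧ levelOf H z = k}

/-- The crossing distance: the number of planes of `H` meeting the closed
segment `[p, q]`. -/
noncomputable def crDist (H : Finset GPlane) (p q : Fin 3 → ℝ) : ℕ :=
  (H.filter (fun h => (gpset h ∩ segment ℝ p q).Nonempty)).card

/-- The `xy`-projection of a point of `ℝ³`. -/
def proj2 (z : Fin 3 → ℝ) : Fin 2 → ℝ := ![z 0, z 1]

/-- General position: no two planes are parallel, no three planes share a
common line, and no four planes share a common point. -/
def GenPos (H : Finset GPlane) : Prop :=
  (∀ h₁ ∈ H, ∀ h₂ ∈ H, h₁ ≠ h₂ → (h₁.1, h₁.2.1) ≠ (h₂.1, h₂.2.1)) ∧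
  (∀ h₁ ∈ H, ∀ h₂ ∈ H, ∀ h₃ ∈ H, h₁ ≠ h₂ → h₂ ≠ h₃ → h₁ ≠ h₃ →
    ∀ x y : Fin 3 → ℝ,
      x ∈ gpset h₁ ∩ gpset h₂ ∩ gpset h₃ →
      y ∈ gpset h₁ ∩ gpset h₂ ∩ gpset h₃ → x = y) ∧
  (∀ h₁ ∈ H, ∀ h₂ ∈ H, ∀ h₃ ∈ H, ∀ h₄ ∈ H,
    h₁ ≠ h₂ → h₁ ≠ h₃ → h₁ ≠ h₄ → h₂ ≠ h₃ → h₂ ≠ h₄ → h₃ ≠ h₄ →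
    ¬ ∃ x : Fin 3 → ℝ,
      x ∈ gpset h₁ ∩ gpset h₂ ∩ gpset h₃ ∩ gpset h₄)

/-- A vertex of the arrangement `Arr(H)`: a point lying on three distinct
planes of `H`. -/
def IsVertex (H : Finset GPlane) (z : Fin 3 → ℝ) : Prop :=
  ∃ h₁ ∈ H, ∃ h₂ ∈ H, ∃ h₃ ∈ H, h₁ ≠ h₂ ∧ h₂ ≠ h₃ ∧ h₁ ≠ h₃ ∧
    z ∈ gpset h₁ ∩ gpset h₂ ∩ gpset h₃

/-- The vector `(a, b)` is nonnegative in the lexicographic order of the plane. -/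
def LexNonneg (a b : ℝ) : Prop := 0 < a ∨ a = 0 ∧ 0 ≤ b

theorem LexNonneg.add {a b a' b' : ℝ} (h : LexNonneg a b) (h' : LexNonneg a' b') :
    LexNonneg (a + a') (b + b') := by
  rcases h with h | ⟨h, hb⟩ <;> rcases h' with h' | ⟨h', hb'⟩
  · exact Or.inl (by linarith)
  · exact Or.inl (by linarith)
  · exact Or.inl (by linarith)
  · exact Or.inr ⟨by linarith, by linarith⟩

theorem LexNonneg.smul {a b t : ℝ} (ht : 0 ≤ t) (h : LexNonneg a b) :
    LexNonneg (t * a) (t * b) := by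
  rcases ht.eq_or_lt with rfl | ht
  · simp [LexNonneg]
  · rcases h with h | ⟨rfl, hb⟩
    · exact Or.inl (by positivity)
    · exact Or.inr ⟨by simp, by positivity⟩

theorem lexNonneg_total (a b : ℝ) : LexNonneg a b ∨ LexNonneg (-a) (-b) := by
  unfold LexNonneg
  rcases lt_trichotomy a 0 with h | rfl | h
  · exact Or.inr (Or.inl (by linarith))
  · rcases le_total 0 b with hb | hb
    · exact Or.inl (Or.inr ⟨rfl, hb⟩)
    · exact Or.inr (Or.inr ⟨by simp, by linarith⟩)
  · exact Or.inl (Or.inl h)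

theorem LexNonneg.eq_zero {a b : ℝ} (h : LexNonneg a b) (h' : LexNonneg (-a) (-b)) :
    a = 0 ∧ b = 0 := by
  rcases h with h | ⟨h, hb⟩ <;> rcases h' with h' | ⟨h', hb'⟩ <;>
    constructor <;> linarith

theorem levelOf_eq_zero_iff {H : Finset GPlane} {z : Fin 3 → ℝ} :
    levelOf H z = 0 ↔ ∀ h ∈ H, z 2 ≤ h.1 * z 0 + h.2.1 * z 1 + h.2.2 := by
  rw [levelOf, Finset.card_eq_zero, Finset.filter_eq_empty_iff]
  simp only [IsBelow, not_lt]

theorem GenPos.mono {H R : Finset GPlane} (hH : GenPos H) (hR : R ⊆ H) : GenPos R :=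
  ⟨fun a ha b hb => hH.1 a (hR ha) b (hR hb),
    fun a ha b hb c hc => hH.2.1 a (hR ha) b (hR hb) c (hR hc),
    fun a ha b hb c hc d hd => hH.2.2 a (hR ha) b (hR hb) c (hR hc) d (hR hd)⟩

/-- Twice the signed area of the triangle spanned by the gradients of three planes. -/
def gradDet (h₁ h₂ h₃ : GPlane) : ℝ :=
  (h₁.1 - h₂.1) * (h₁.2.1 - h₃.2.1) - (h₁.1 - h₃.1) * (h₁.2.1 - h₂.2.1)

theorem gradDet_rotate (h₁ h₂ h₃ : GPlane) : gradDet h₂ h₃ h₁ = gradDet h₁ h₂ h₃ := by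
  unfold gradDet; ring

theorem gradDet_swap (h₁ h₂ h₃ : GPlane) : gradDet h₁ h₃ h₂ = -gradDet h₁ h₂ h₃ := by
  unfold gradDet; ring

theorem GenPos.gradDet_ne_zero {H : Finset GPlane} (hH : GenPos H) {h₁ h₂ h₃ : GPlane}
    (m₁ : h₁ ∈ H) (m₂ : h₂ ∈ H) (m₃ : h₃ ∈ H) (h12 : h₁ ≠ h₂) (h23 : h₂ ≠ h₃) (h13 : h₁ ≠ h₃)
    {v : Fin 3 → ℝ} (hv : v ∈ gpset h₁ ∩ gpset h₂ ∩ gpset h₃) : gradDet h₁ h₂ h₃ ≠ 0 := by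
  intro h0
  have hpar := hH.1 h₁ m₁ h₂ m₂ h12
  obtain ⟨⟨v1, v2⟩, v3⟩ := hv
  simp only [gpset, Set.mem_ofPred_eq] at v1 v2 v3
  unfold gradDet at h0
  have key := hH.2.1 h₁ m₁ h₂ m₂ h₃ m₃ h12 h23 h13 v
    ![v 0 - (h₁.2.1 - h₂.2.1), v 1 + (h₁.1 - h₂.1),
      v 2 - h₁.1 * (h₁.2.1 - h₂.2.1) + h₁.2.1 * (h₁.1 - h₂.1)] ⟨⟨v1, v2⟩, v3⟩ (by
      refine ⟨⟨?_, ?_⟩, ?_⟩ <;> simp [gpset] <;> linarith)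
  have e0 := congrFun key 0
  have e1 := congrFun key 1
  simp at e0 e1
  exact hpar (Prod.ext (by simp; linarith) (by simp; linarith))

/-- `v` is the lexicographically extremal point, in the direction `σ`, of the part of `h` on the
lower envelope of `R`. -/
def IsFaceExtreme (R : Finset GPlane) (v : Fin 3 → ℝ) (h : GPlane) (σ : ℝ) : Prop :=
  v ∈ gpset h ∧ levelOf R v = 0 ∧
    ∀ w ∈ gpset h, levelOf R w = 0 → LexNonneg (σ * (w 0 - v 0)) (σ * (w 1 - v 1))

theorem IsFaceExtreme.unique {R : Finset GPlane} {v w : Fin 3 → ℝ} {h : GPlane} {σ : ℝ}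
    (hσ : σ ≠ 0) (hv : IsFaceExtreme R v h σ) (hw : IsFaceExtreme R w h σ) : v = w := by
  have h1 := hv.2.2 w hw.1 hw.2.1
  have h2 := hw.2.2 v hv.1 hv.2.1
  obtain ⟨e0, e1⟩ := h1.eq_zero (by convert h2 using 1 <;> ring)
  have e0 : v 0 = w 0 := by
    have := (mul_eq_zero.1 e0).resolve_left hσ; linarith
  have e1 : v 1 = w 1 := by
    have := (mul_eq_zero.1 e1).resolve_left hσ; linarith
  have hv1 := hv.1
  have hw1 := hw.1
  simp only [gpset, Set.mem_ofPred_eq] at hv1 hw1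
  funext i
  fin_cases i
  · exact e0
  · exact e1
  · change v 2 = w 2
    rw [hv1, hw1, e0, e1]

/-- If both edges of the face of `h₁` at the vertex `v` point in the direction `σ`, then `v` is
extremal on that face. -/
theorem isFaceExtreme_of_edges {R : Finset GPlane} {h₁ h₂ h₃ : GPlane} {v : Fin 3 → ℝ} {σ : ℝ}
    (m₂ : h₂ ∈ R) (m₃ : h₃ ∈ R) (hD : 0 < gradDet h₁ h₂ h₃)
    (v1 : v ∈ gpset h₁) (v2 : v ∈ gpset h₂) (v3 : v ∈ gpset h₃) (hv : levelOf R v = 0)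
    (h12 : LexNonneg (σ * (h₁.2.1 - h₂.2.1)) (σ * (h₂.1 - h₁.1)))
    (h31 : LexNonneg (σ * (h₃.2.1 - h₁.2.1)) (σ * (h₁.1 - h₃.1))) :
    IsFaceExtreme R v h₁ σ := by
  refine ⟨v1, hv, fun w w1 hw => ?_⟩
  have w2 := levelOf_eq_zero_iff.1 hw h₂ m₂
  have w3 := levelOf_eq_zero_iff.1 hw h₃ m₃
  simp only [gpset, Set.mem_ofPred_eq] at v1 v2 v3 w1
  have a2 : 0 ≤ -((h₁.1 - h₂.1) * (w 0 - v 0) + (h₁.2.1 - h₂.2.1) * (w 1 - v 1)) := by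
    linarith
  have a3 : 0 ≤ -((h₁.1 - h₃.1) * (w 0 - v 0) + (h₁.2.1 - h₃.2.1) * (w 1 - v 1)) := by
    linarith
  have key := ((h12.smul a3).add (h31.smul a2)).smul (inv_nonneg.2 hD.le)
  convert key using 1 <;> rw [eq_inv_mul_iff_mul_eq₀ hD.ne'] <;> unfold gradDet <;> ring

theorem exists_isFaceExtreme_of_pos {R : Finset GPlane} {h₁ h₂ h₃ : GPlane} {v : Fin 3 → ℝ}
    (m₁ : h₁ ∈ R) (m₂ : h₂ ∈ R) (m₃ : h₃ ∈ R) (hD : 0 < gradDet h₁ h₂ h₃)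
    (v1 : v ∈ gpset h₁) (v2 : v ∈ gpset h₂) (v3 : v ∈ gpset h₃) (hv : levelOf R v = 0) :
    ∃ h ∈ R, ∃ σ ∈ ({1, -1} : Finset ℝ), IsFaceExtreme R v h σ := by
  have hD2 : 0 < gradDet h₂ h₃ h₁ := by rwa [gradDet_rotate]
  have hD3 : 0 < gradDet h₃ h₁ h₂ := by rwa [gradDet_rotate, gradDet_rotate]
  have E1 := fun σ => isFaceExtreme_of_edges (σ := σ) m₂ m₃ hD v1 v2 v3 hv
  have E2 := fun σ => isFaceExtreme_of_edges (σ := σ) m₃ m₁ hD2 v2 v3 v1 hv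
  have E3 := fun σ => isFaceExtreme_of_edges (σ := σ) m₁ m₂ hD3 v3 v1 v2 hv
  have tot : ∀ a b : ℝ, LexNonneg (1 * a) (1 * b) ∨ LexNonneg (-1 * a) (-1 * b) := fun a b => by
    simpa using lexNonneg_total a b
  have p : (1 : ℝ) ∈ ({1, -1} : Finset ℝ) := by simp
  have n : (-1 : ℝ) ∈ ({1, -1} : Finset ℝ) := by simp
  rcases tot (h₁.2.1 - h₂.2.1) (h₂.1 - h₁.1) with ha | ha <;>
    rcases tot (h₂.2.1 - h₃.2.1) (h₃.1 - h₂.1) with hb | hb <;>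
    rcases tot (h₃.2.1 - h₁.2.1) (h₁.1 - h₃.1) with hc | hc
  · exact ⟨h₁, m₁, 1, p, E1 1 ha hc⟩
  · exact ⟨h₂, m₂, 1, p, E2 1 hb ha⟩
  · exact ⟨h₁, m₁, 1, p, E1 1 ha hc⟩
  · exact ⟨h₃, m₃, -1, n, E3 (-1) hc hb⟩
  · exact ⟨h₃, m₃, 1, p, E3 1 hc hb⟩
  · exact ⟨h₁, m₁, -1, n, E1 (-1) ha hc⟩
  · exact ⟨h₂, m₂, -1, n, E2 (-1) hb ha⟩
  · exact ⟨h₁, m₁, -1, n, E1 (-1) ha hc⟩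

theorem exists_isFaceExtreme {R : Finset GPlane} (hR : GenPos R) {v : Fin 3 → ℝ}
    (hv : IsVertex R v) (hl : levelOf R v = 0) :
    ∃ h ∈ R, ∃ σ ∈ ({1, -1} : Finset ℝ), IsFaceExtreme R v h σ := by
  obtain ⟨h₁, m₁, h₂, m₂, h₃, m₃, h12, h23, h13, hmem⟩ := hv
  have hD := hR.gradDet_ne_zero m₁ m₂ m₃ h12 h23 h13 hmem
  obtain ⟨⟨v1, v2⟩, v3⟩ := hmem
  rcases hD.lt_or_gt with hD | hD
  · exact exists_isFaceExtreme_of_pos m₁ m₃ m₂ (by rw [gradDet_swap]; linarith) v1 v3 v2 hl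
  · exact exists_isFaceExtreme_of_pos m₁ m₂ m₃ hD v1 v2 v3 hl

/-- The lower envelope of planes in general position has linearly many vertices. -/
theorem card_envelope_vertices_le {R : Finset GPlane} (hR : GenPos R) (V : Finset (Fin 3 → ℝ))
    (hV : ∀ v ∈ V, IsVertex R v ∧ levelOf R v = 0) : V.card ≤ 2 * R.card := by
  have hex : ∀ v ∈ V, ∃ p ∈ R ×ˢ ({1, -1} : Finset ℝ), IsFaceExtreme R v p.1 p.2 := by
    intro v hv
    obtain ⟨h, mh, σ, mσ, he⟩ := exists_isFaceExtreme hR (hV v hv).1 (hV v hv).2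
    exact ⟨(h, σ), Finset.mem_product.2 ⟨mh, mσ⟩, he⟩
  choose! f hf hfe using hex
  have hle : V.card ≤ (R ×ˢ ({1, -1} : Finset ℝ)).card := by
    refine Finset.card_le_card_of_injOn f hf fun v hv w hw hvw => ?_
    have hσ := (Finset.mem_product.1 (hf v hv)).2
    refine IsFaceExtreme.unique (h := (f v).1) (σ := (f v).2) ?_ (hfe v hv) (hvw ▸ hfe w hw)
    intro h0
    rw [h0] at hσ
    norm_num at hσ
  rw [Finset.card_product] at hle
  have : ({1, -1} : Finset ℝ).card ≤ 2 := Finset.card_le_two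
  nlinarith

/-- The probability that a random subset of `H`, each element being kept with probability `p`,
contains `A` and avoids `B`. -/
theorem sum_weight_contains_avoids {α : Type*} [DecidableEq α] {H A B : Finset α} (hA : A ⊆ H)
    (hB : B ⊆ H) (hAB : Disjoint A B) (p : ℝ) :
    ∑ R ∈ H.powerset with A ⊆ R ∧ Disjoint R B, p ^ R.card * (1 - p) ^ (H \ R).card
      = p ^ A.card * (1 - p) ^ B.card := by
  have h := Finset.prod_add (fun i => if i ∈ B then 0 else p)
    (fun i => if i ∈ A then 0 else 1 - p) H
  have hl : ∏ i ∈ H, ((if i ∈ B then 0 else p) + (if i ∈ A then 0 else 1 - p))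
      = p ^ A.card * (1 - p) ^ B.card := by
    have : ∀ i ∈ H, ((if i ∈ B then 0 else p) + (if i ∈ A then 0 else 1 - p))
        = (if i ∈ A then p else 1) * (if i ∈ B then 1 - p else 1) := by
      intro i _
      by_cases ha : i ∈ A
      · simp [ha, Finset.disjoint_left.1 hAB ha]
      · by_cases hb : i ∈ B <;> simp [ha, hb]
    rw [Finset.prod_congr rfl this, Finset.prod_mul_distrib, Finset.prod_ite_mem,
      Finset.prod_ite_mem, Finset.inter_eq_right.2 hA, Finset.inter_eq_right.2 hB]
    simp
  rw [← hl, h, Finset.sum_filter]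
  refine Finset.sum_congr rfl fun R hR => ?_
  split_ifs with hc
  · congr 1
    · rw [← Finset.prod_const]
      exact Finset.prod_congr rfl fun i hi => by simp [Finset.disjoint_left.1 hc.2 hi]
    · rw [← Finset.prod_const]
      refine Finset.prod_congr rfl fun i hi => ?_
      have : i ∉ A := fun ha => (Finset.mem_sdiff.1 hi).2 (hc.1 ha)
      simp [this]
  · symm
    rw [not_and_or] at hc
    rcases hc with hc | hc
    · obtain ⟨i, hi, hiR⟩ := Finset.not_subset.1 hc
      rw [Finset.prod_eq_zero (i := i) (s := H \ R) (Finset.mem_sdiff.2 ⟨hA hi, hiR⟩)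
        (by simp [hi]), mul_zero]
    · obtain ⟨i, hiR, hi⟩ := Finset.not_disjoint_iff.1 hc
      rw [Finset.prod_eq_zero (i := i) (s := R) hiR (by simp [hi]), zero_mul]

/-- The expected cardinality of a random subset of `H`. -/
theorem sum_weight_mul_card {α : Type*} [DecidableEq α] (H : Finset α) (p : ℝ) :
    ∑ R ∈ H.powerset, p ^ R.card * (1 - p) ^ (H \ R).card * (R.card : ℝ) = p * H.card := by
  have h1 : ∀ R ∈ H.powerset, p ^ R.card * (1 - p) ^ (H \ R).card * (R.card : ℝ)
      = ∑ i ∈ H, if i ∈ R then p ^ R.card * (1 - p) ^ (H \ R).card else 0 := by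
    intro R hR
    rw [Finset.sum_ite_mem, Finset.inter_eq_right.2 (Finset.mem_powerset.1 hR)]
    simp [mul_comm]
  rw [Finset.sum_congr rfl h1, Finset.sum_comm]
  have h2 : ∀ i ∈ H, ∑ R ∈ H.powerset,
      (if i ∈ R then p ^ R.card * (1 - p) ^ (H \ R).card else 0) = p := by
    intro i hi
    have := sum_weight_contains_avoids (A := {i}) (B := ∅) (Finset.singleton_subset_iff.2 hi)
      (Finset.empty_subset H) (Finset.disjoint_empty_right _) p
    simpa [Finset.sum_filter] using this
  rw [Finset.sum_congr rfl h2]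
  simp [mul_comm]

/-- A vertex of `H` is determined by three planes of `H`, and is a vertex of every set of planes
containing them. -/
theorem IsVertex.exists_finset {H : Finset GPlane} {z : Fin 3 → ℝ} (hz : IsVertex H z) :
    ∃ T ⊆ H, T.card = 3 ∧ (∀ h ∈ T, z ∈ gpset h) ∧ ∀ R, T ⊆ R → IsVertex R z := by
  obtain ⟨h₁, m₁, h₂, m₂, h₃, m₃, h12, h23, h13, ⟨v1, v2⟩, v3⟩ := hz
  refine ⟨{h₁, h₂, h₃}, by simp [Finset.insert_subset_iff, m₁, m₂, m₃],
    Finset.card_eq_three.2 ⟨h₁, h₂, h₃, h12, h13, h23, rfl⟩, by simp [v1, v2, v3],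
    fun R hR => ⟨h₁, hR (by simp), h₂, hR (by simp), h₃, hR (by simp), h12, h23, h13,
      ⟨v1, v2⟩, v3⟩⟩

theorem GenPos.finite_vertices {H : Finset GPlane} (hH : GenPos H) :
    {z | IsVertex H z}.Finite := by
  have hsub : {z | IsVertex H z} ⊆ ⋃ t ∈ H ×ˢ H ×ˢ H,
      {z | t.1 ≠ t.2.1 ∧ t.2.1 ≠ t.2.2 ∧ t.1 ≠ t.2.2 ∧
        z ∈ gpset t.1 ∩ gpset t.2.1 ∩ gpset t.2.2} := by
    rintro z ⟨h₁, m₁, h₂, m₂, h₃, m₃, hz⟩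
    exact Set.mem_biUnion (x := (h₁, h₂, h₃)) (by simp [m₁, m₂, m₃]) hz
  refine (Set.Finite.biUnion (Finset.finite_toSet _) fun t ht => ?_).subset hsub
  simp only [Finset.coe_product, Set.mem_prod, Finset.mem_coe] at ht
  exact Set.Subsingleton.finite fun x hx y hy =>
    hH.2.1 _ ht.1 _ ht.2.1 _ ht.2.2 hx.1 hx.2.1 hx.2.2.1 x y hx.2.2.2 hy.2.2.2

/-- The Clarkson–Shor bound on the number of vertices at level at most `k`. -/
theorem card_vertices_level_le {H : Finset GPlane} (hH : GenPos H) (k : ℕ)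
    (V : Finset (Fin 3 → ℝ)) (hV : ∀ v ∈ V, IsVertex H v ∧ levelOf H v ≤ k) :
    (V.card : ℝ) ≤ 16 * H.card * ((k : ℝ) + 1) ^ 2 := by
  have hT : ∀ v ∈ V, ∃ T ⊆ H, T.card = 3 ∧ (∀ h ∈ T, v ∈ gpset h) ∧
      ∀ R, T ⊆ R → IsVertex R v := fun v hv => (hV v hv).1.exists_finset
  choose! T hTH hT3 hTv hTR using hT
  set B : (Fin 3 → ℝ) → Finset GPlane := fun v => H.filter (fun h => IsBelow h v) with hB
  obtain ⟨p, hp⟩ : ∃ p : ℝ, p = 1 / (2 * ((k : ℝ) + 1)) := ⟨_, rfl⟩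
  have hk : (0 : ℝ) < (k : ℝ) + 1 := by positivity
  have hpk : p * ((k : ℝ) + 1) = 1 / 2 := by rw [hp]; field_simp
  have hp0 : 0 < p := by rw [hp]; positivity
  have hp1 : p ≤ 1 / 2 := by nlinarith [Nat.cast_nonneg (α := ℝ) k]
  set w : Finset GPlane → ℝ := fun R => p ^ R.card * (1 - p) ^ (H \ R).card with hw
  have hw0 : ∀ R, 0 ≤ w R := fun R => mul_nonneg (by positivity) (pow_nonneg (by linarith) _)
  have hpow : 1 / 2 ≤ (1 - p) ^ k := by
    have := one_add_mul_le_pow (a := -p) (by linarith) k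
    rw [← sub_eq_add_neg] at this
    linarith
  have hlow : ∀ v ∈ V, p ^ 3 * (1 / 2) ≤
      ∑ R ∈ H.powerset, if T v ⊆ R ∧ Disjoint R (B v) then w R else 0 := by
    intro v hv
    have hdis : Disjoint (T v) (B v) := by
      refine Finset.disjoint_left.2 fun h hh hb => ?_
      have h1 := hTv v hv h hh
      have h2 := (Finset.mem_filter.1 hb).2
      simp only [gpset, Set.mem_ofPred_eq, IsBelow] at h1 h2
      linarith
    rw [← Finset.sum_filter,
      sum_weight_contains_avoids (hTH v hv) (Finset.filter_subset _ _) hdis p, hT3 v hv]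
    have : (1 - p) ^ k ≤ (1 - p) ^ (B v).card :=
      pow_le_pow_of_le_one (by linarith) (by linarith) (hV v hv).2
    gcongr
    linarith
  have hup : ∀ R ∈ H.powerset,
      (∑ v ∈ V, if T v ⊆ R ∧ Disjoint R (B v) then w R else 0) ≤ w R * (2 * R.card) := by
    intro R hR
    have hRH := Finset.mem_powerset.1 hR
    rw [← Finset.sum_filter, Finset.sum_const, nsmul_eq_mul, mul_comm]
    refine mul_le_mul_of_nonneg_left ?_ (hw0 R)
    have := card_envelope_vertices_le (hH.mono hRH)
      (V.filter fun v => T v ⊆ R ∧ Disjoint R (B v)) (by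
        intro v hv
        obtain ⟨hv, hTv, hd⟩ := Finset.mem_filter.1 hv
        refine ⟨hTR v hv R hTv, Finset.card_eq_zero.2 (Finset.filter_eq_empty_iff.2 ?_)⟩
        intro h hh hb
        exact Finset.disjoint_left.1 hd hh (Finset.mem_filter.2 ⟨hRH hh, hb⟩))
    exact_mod_cast this
  have hmain : (V.card : ℝ) * (p ^ 3 * (1 / 2)) ≤ 2 * (p * H.card) := by
    calc (V.card : ℝ) * (p ^ 3 * (1 / 2)) = ∑ v ∈ V, p ^ 3 * (1 / 2) := by simp
      _ ≤ _ := Finset.sum_le_sum hlow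
      _ = _ := Finset.sum_comm
      _ ≤ _ := Finset.sum_le_sum hup
      _ = 2 * ∑ R ∈ H.powerset, w R * R.card := by
        rw [Finset.mul_sum]; exact Finset.sum_congr rfl fun R _ => by ring
      _ = _ := by rw [sum_weight_mul_card]
  have hmain' : (V.card : ℝ) * p ^ 2 ≤ 4 * H.card := by
    refine le_of_mul_le_mul_left ?_ hp0
    linarith
  have h4 : (V.card : ℝ) = V.card * p ^ 2 * (4 * ((k : ℝ) + 1) ^ 2) := by
    have : p ^ 2 * ((k : ℝ) + 1) ^ 2 = 1 / 4 := by rw [← mul_pow, hpk]; norm_num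
    linear_combination (-4 * (V.card : ℝ)) * this
  rw [h4]
  nlinarith [mul_le_mul_of_nonneg_right hmain' (by positivity : 0 ≤ 4 * ((k : ℝ) + 1) ^ 2)]

/-- Each `v` lies in at most three windows `ξ - 2 ≤ f v ≤ ξ`, so some `ξ` in `S` has a window
holding at most `3 * #V / #S` elements. -/
theorem exists_card_window_le {α : Type*} (V : Finset α) (f : α → ℕ) {S : Finset ℕ}
    (hS : S.Nonempty) :
    ∃ ξ ∈ S, S.card * (V.filter fun v => ξ ≤ f v + 2 ∧ f v ≤ ξ).card ≤ 3 * V.card := by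
  obtain ⟨ξ, hξ, hmin⟩ :=
    S.exists_min_image (fun ξ => (V.filter fun v => ξ ≤ f v + 2 ∧ f v ≤ ξ).card) hS
  refine ⟨ξ, hξ, ?_⟩
  calc _ ≤ ∑ ξ ∈ S, (V.filter fun v => ξ ≤ f v + 2 ∧ f v ≤ ξ).card := by
        rw [← smul_eq_mul]; exact Finset.card_nsmul_le_sum _ _ _ hmin
    _ = ∑ v ∈ V, (S.filter fun ξ => ξ ≤ f v + 2 ∧ f v ≤ ξ).card :=
        Finset.sum_card_bipartiteAbove_eq_sum_card_bipartiteBelow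
          (fun ξ v => ξ ≤ f v + 2 ∧ f v ≤ ξ)
    _ ≤ ∑ v ∈ V, 3 := by
        refine Finset.sum_le_sum fun v _ => ?_
        calc _ ≤ (Finset.Icc (f v) (f v + 2)).card := Finset.card_le_card fun ξ hξ => by
              have := (Finset.mem_filter.1 hξ).2
              exact Finset.mem_Icc.2 ⟨this.2, this.1⟩
          _ = 3 := by rw [Nat.card_Icc]; omega
    _ = _ := by simp [mul_comm]

/-- The number of vertices of `Arr(H)` at level at most `k`
is `O(nk²)` (Clarkson–Shor); consequently, for `0 < c < 1` and `r` with
`cn/r ≥ 1`, some level `ξ ∈ [(1+c)n/r, (1+2c)n/r]` has complexity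
`O(n²/(cr))`, where the complexity of level `ξ` counts the vertices of
`Arr(H)` appearing on the `ξ`-level, i.e. those at level in `[ξ−2, ξ]`. -/
theorem at_most_k_level_complexity :
    ∃ C : ℝ, 0 < C ∧
      ∀ H : Finset GPlane, GenPos H →
        (∀ k : ℕ,
          {z | IsVertex H z ∧ levelOf H z ≤ k}.Finite ∧
          ({z | IsVertex H z ∧ levelOf H z ≤ k}.ncard : ℝ)
            ≤ C * (H.card : ℝ) * ((k : ℝ) + 1) ^ 2) ∧
        (∀ c r : ℝ, 0 < c → c < 1 → 0 < r →
          1 ≤ c * (H.card : ℝ) / r →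
          ∃ ξ : ℕ,
            (1 + c) * (H.card : ℝ) / r ≤ (ξ : ℝ) ∧
            (ξ : ℝ) ≤ (1 + 2 * c) * (H.card : ℝ) / r ∧
            {z | IsVertex H z ∧ ξ ≤ levelOf H z + 2 ∧ levelOf H z ≤ ξ}.Finite ∧
            ({z | IsVertex H z ∧ ξ ≤ levelOf H z + 2 ∧
                levelOf H z ≤ ξ}.ncard : ℝ)
              ≤ C * (H.card : ℝ) ^ 2 / (c * r)) := by
  refine ⟨1536, by norm_num, fun H hH => ⟨fun k => ?_, fun c r hc hc1 hr hL => ?_⟩⟩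
  · have hfin : {z | IsVertex H z ∧ levelOf H z ≤ k}.Finite :=
      hH.finite_vertices.subset fun z hz => hz.1
    refine ⟨hfin, ?_⟩
    rw [Set.ncard_eq_toFinset_card _ hfin]
    refine (card_vertices_level_le hH k _ fun v hv => by simpa using hv).trans ?_
    gcongr
    norm_num
  · obtain ⟨q, hq⟩ : ∃ q : ℝ, q = (H.card : ℝ) / r := ⟨_, rfl⟩
    have hq0 : 0 ≤ q := by rw [hq]; positivity
    have hL' : 1 ≤ c * q := by rw [hq, ← mul_div_assoc]; exact hL
    have hq1 : 1 ≤ q := by nlinarith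
    rw [mul_div_assoc, mul_div_assoc, ← hq]
    set a : ℕ := ⌈(1 + c) * q⌉₊ with ha
    set b : ℕ := ⌊(1 + 2 * c) * q⌋₊ with hb
    have ha' : (a : ℝ) < (1 + c) * q + 1 := Nat.ceil_lt_add_one (by positivity)
    have hb' : (b : ℝ) ≤ (1 + 2 * c) * q := Nat.floor_le (by positivity)
    have hb'' : (1 + 2 * c) * q < (b : ℝ) + 1 := Nat.lt_floor_add_one _
    have hab : a ≤ b := Nat.le_floor (by nlinarith)
    have hS : (Finset.Icc a b).Nonempty := Finset.nonempty_Icc.2 hab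
    have hScard : c * q ≤ 2 * ((Finset.Icc a b).card : ℝ) := by
      rw [Nat.card_Icc, Nat.cast_sub (by omega)]
      have : (a : ℝ) ≤ b := by exact_mod_cast hab
      push_cast
      linarith
    have hfin : {z | IsVertex H z ∧ levelOf H z ≤ b}.Finite :=
      hH.finite_vertices.subset fun z hz => hz.1
    obtain ⟨ξ, hξ, hcard⟩ := exists_card_window_le hfin.toFinset (levelOf H) hS
    obtain ⟨hξa, hξb⟩ := Finset.mem_Icc.1 hξ
    have hset : {z | IsVertex H z ∧ ξ ≤ levelOf H z + 2 ∧ levelOf H z ≤ ξ} =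
        (hfin.toFinset.filter fun z => ξ ≤ levelOf H z + 2 ∧ levelOf H z ≤ ξ : Set _) := by
      ext z
      simp only [Set.mem_ofPred_eq, Finset.coe_filter, Set.Finite.mem_toFinset]
      exact ⟨fun h => ⟨⟨h.1, h.2.2.trans hξb⟩, h.2⟩, fun h => ⟨h.1.1, h.2⟩⟩
    refine ⟨ξ, (Nat.le_ceil _).trans (by exact_mod_cast hξa),
      le_trans (by exact_mod_cast hξb) hb', ?_⟩
    rw [hset]
    refine ⟨Finset.finite_toSet _, ?_⟩
    rw [Set.ncard_coe_finset]
    set M := (hfin.toFinset.filter fun z => ξ ≤ levelOf H z + 2 ∧ levelOf H z ≤ ξ).card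
    have hN := card_vertices_level_le hH b hfin.toFinset fun v hv => by simpa using hv
    have hcard' : ((Finset.Icc a b).card : ℝ) * M ≤ 3 * hfin.toFinset.card := by
      exact_mod_cast hcard
    have hb4 : (b : ℝ) + 1 ≤ 4 * q := by nlinarith
    have hN' : (hfin.toFinset.card : ℝ) ≤ 16 * H.card * (4 * q) ^ 2 := hN.trans (by gcongr)
    have hM : c * q * M ≤ 1536 * H.card * q * q := by
      have := mul_le_mul_of_nonneg_right hScard (Nat.cast_nonneg (α := ℝ) M)
      nlinarith
    have hM' : c * M ≤ 1536 * H.card * q := by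
      refine le_of_mul_le_mul_right ?_ (by linarith : 0 < q)
      linarith
    rw [le_div_iff₀ (by positivity)]
    have hqr : q * r = H.card := by rw [hq]; field_simp
    calc (M : ℝ) * (c * r) = c * M * r := by ring
      _ ≤ 1536 * H.card * q * r := by gcongr
      _ = 1536 * (H.card : ℝ) ^ 2 := by rw [mul_assoc, hqr]; ring
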